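/- arXiv:1306.3003 — 5 statements merged into one kernel-verified Lean document; each statement's English description precedes it below -/
import Mathlib

section
/- Let E be a real inner product space and suppose a finite dataset is partitioned into c+1 clusters (c ≥ 1, real parameters λ, θ), where each cluster's center is its mean. Suppose two of the clusters have sizes n₁, n₂ ≥ 1 and means μ₁, μ₂, and that ‖μ₁ − μ₂‖² < ((n₁+n₂)/(n₁·n₂))·(λ − θ·ln((c+1)^(c+1)/c^c)). Then merging these two clusters into a single cluster whose center is the mean of their union, yielding a partition into c clusters, strictly decreases the pyp-means objective: (km-cost after merging) + (λ − θ·ln c)·c < (km-cost before merging) + (λ − θ·ln(c+1))·(c+1). -/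
open Finset

/-- The km-cost (within-cluster cost) of a finite family of points: the sum of the
squared distances of the points to their mean. -/
noncomputable def kmCost {E : Type*} [NormedAddCommGroup E] [InnerProductSpace ℝ E]
    {n : ℕ} (x : Fin n → E) : ℝ :=
  ∑ i, ‖x i - (n : ℝ)⁻¹ • ∑ j, x j‖ ^ 2

/-- The sum of squared distances to a point `a` exceeds the km-cost by `n` times the squared
distance from the mean to `a`. -/
theorem sum_norm_sub_sq_eq_kmCost_add {E : Type*} [NormedAddCommGroup E] [InnerProductSpace ℝ E]
    {n : ℕ} (x : Fin n → E) (a : E) :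
    ∑ i, ‖x i - a‖ ^ 2 = kmCost x + n * ‖(n : ℝ)⁻¹ • ∑ j, x j - a‖ ^ 2 := by
  set μ := (n : ℝ)⁻¹ • ∑ j, x j with hμ
  have hdev : ∑ i, (x i - μ) = 0 := by
    rcases Nat.eq_zero_or_pos n with rfl | hn
    · simp
    · have hn' : (n : ℝ) ≠ 0 := by positivity
      rw [sum_sub_distrib, sum_const, card_univ, Fintype.card_fin, ← Nat.cast_smul_eq_nsmul ℝ, hμ,
        smul_inv_smul₀ hn', sub_self]
  have hexpand : ∀ i, ‖x i - a‖ ^ 2 =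
      ‖x i - μ‖ ^ 2 + 2 * inner ℝ (x i - μ) (μ - a) + ‖μ - a‖ ^ 2 := fun i => by
    rw [← norm_add_sq_real, sub_add_sub_cancel]
  simp_rw [hexpand, sum_add_distrib, ← mul_sum, ← sum_inner, hdev]
  simp [kmCost, hμ]

/-- Merging two clusters increases the km-cost by the reduced size times the squared distance
between the means. -/
theorem kmCost_append {E : Type*} [NormedAddCommGroup E] [InnerProductSpace ℝ E]
    {n₁ n₂ : ℕ} (h₁ : 1 ≤ n₁) (h₂ : 1 ≤ n₂) (x : Fin n₁ → E) (y : Fin n₂ → E) :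
    kmCost (Fin.append x y) = kmCost x + kmCost y + (n₁ * n₂ : ℝ) / (n₁ + n₂) *
      ‖(n₁ : ℝ)⁻¹ • ∑ i, x i - (n₂ : ℝ)⁻¹ • ∑ i, y i‖ ^ 2 := by
  have hn₁ : (0 : ℝ) < n₁ := by exact_mod_cast h₁
  have hn₂ : (0 : ℝ) < n₂ := by exact_mod_cast h₂
  set a := (n₁ : ℝ)⁻¹ • ∑ i, x i with ha
  set b := (n₂ : ℝ)⁻¹ • ∑ i, y i with hb
  have hx : ∑ i, x i = (n₁ : ℝ) • a := by rw [ha, smul_inv_smul₀ hn₁.ne']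
  have hy : ∑ i, y i = (n₂ : ℝ) • b := by rw [hb, smul_inv_smul₀ hn₂.ne']
  have hleft : a - ((n₁ + n₂ : ℕ) : ℝ)⁻¹ • ((n₁ : ℝ) • a + (n₂ : ℝ) • b) =
      ((n₂ : ℝ) / (n₁ + n₂)) • (a - b) := by
    push_cast
    match_scalars <;> field_simp
    ring
  have hright : b - ((n₁ + n₂ : ℕ) : ℝ)⁻¹ • ((n₁ : ℝ) • a + (n₂ : ℝ) • b) =
      (-(n₁ : ℝ) / (n₁ + n₂)) • (a - b) := by
    push_cast
    match_scalars <;> field_simp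
    ring
  rw [kmCost]
  simp only [Fin.sum_univ_add, Fin.append_left, Fin.append_right]
  rw [sum_norm_sub_sq_eq_kmCost_add x, sum_norm_sub_sq_eq_kmCost_add y, ← ha, ← hb, hx, hy,
    hleft, hright, norm_smul, norm_smul, mul_pow, mul_pow, Real.norm_eq_abs, Real.norm_eq_abs,
    sq_abs, sq_abs]
  field_simp
  ring

/-- If two clusters of a `(c+1)`-cluster partition have sizes `n₁, n₂` and means
`μ₁, μ₂` with `‖μ₁ − μ₂‖² < ((n₁+n₂)/(n₁·n₂))·(λ − θ·ln((c+1)^(c+1)/c^c))`, then merging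
them strictly decreases the pyp-means objective. -/
theorem stmt1 {E : Type*} [NormedAddCommGroup E] [InnerProductSpace ℝ E]
    (c : ℕ) (hc : 1 ≤ c) (lam θ : ℝ)
    (m : Fin (c + 1) → ℕ) (hm : ∀ k, 1 ≤ m k)
    (p : (k : Fin (c + 1)) → Fin (m k) → E)
    (k₁ k₂ : Fin (c + 1)) (hk : k₁ ≠ k₂)
    (μ₁ μ₂ : E)
    (hμ₁ : μ₁ = (m k₁ : ℝ)⁻¹ • ∑ i, p k₁ i)
    (hμ₂ : μ₂ = (m k₂ : ℝ)⁻¹ • ∑ i, p k₂ i)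
    (hsep : ‖μ₁ - μ₂‖ ^ 2 < (((m k₁ : ℝ) + (m k₂ : ℝ)) / ((m k₁ : ℝ) * (m k₂ : ℝ))) *
      (lam - θ * Real.log (((c : ℝ) + 1) ^ (c + 1) / (c : ℝ) ^ c))) :
    (∑ k ∈ (Finset.univ.erase k₁).erase k₂, kmCost (p k))
        + kmCost (Fin.append (p k₁) (p k₂))
        + (lam - θ * Real.log (c : ℝ)) * (c : ℝ)
      < (∑ k, kmCost (p k)) + (lam - θ * Real.log ((c : ℝ) + 1)) * ((c : ℝ) + 1) := by
  have hn₁ : (0 : ℝ) < m k₁ := by exact_mod_cast hm k₁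
  have hn₂ : (0 : ℝ) < m k₂ := by exact_mod_cast hm k₂
  have hc' : (0 : ℝ) < c := by exact_mod_cast hc
  have hincrease : (m k₁ * m k₂ : ℝ) / (m k₁ + m k₂) * ‖μ₁ - μ₂‖ ^ 2 <
      lam - θ * Real.log (((c : ℝ) + 1) ^ (c + 1) / (c : ℝ) ^ c) := by
    rw [← inv_div, inv_mul_lt_iff₀ (by positivity)]
    exact hsep
  rw [Real.log_div (by positivity) (by positivity), Real.log_pow, Real.log_pow] at hincrease
  push_cast at hincrease
  rw [kmCost_append (hm k₁) (hm k₂), ← hμ₁, ← hμ₂,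
    ← add_sum_erase univ (fun k => kmCost (p k)) (mem_univ k₁),
    ← add_sum_erase (univ.erase k₁) (fun k => kmCost (p k))
      (mem_erase.mpr ⟨hk.symm, mem_univ k₂⟩)]
  linarith
end

section
/- Let E be a real inner product space, x ∈ E, let μ₁, …, μ_c ∈ E (c ≥ 1) be existing cluster centers with positive sizes n₁, …, n_c, and let λ, θ ∈ ℝ and ρ > 0. For ε > 0 define the unnormalized Gibbs weights q_k(ε) = n_k·exp(−(θ + ‖x − μ_k‖²)/(2ε)) for existing clusters k and q_new(ε) = exp(−(λ − θ·ln c)/(2ε) − ‖x‖²/(ε+ρ)) for a new cluster, with Z(ε) = q_new(ε) + Σ_k q_k(ε). Then as ε → 0⁺: (i) if λ − θ·ln c < min_k (θ + ‖x − μ_k‖²), then q_new(ε)/Z(ε) → 1; (ii) if there is k₀ with θ + ‖x − μ_{k₀}‖² < λ − θ·ln c and ‖x − μ_{k₀}‖² < ‖x − μ_k‖² for all k ≠ k₀, then q_{k₀}(ε)/Z(ε) → 1. Hence in the limit the point x is assigned according to the minimizer of {λ − θ·ln c, θ + ‖x − μ_k‖², k = 1, …, c}. -/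
open Filter

lemma tendsto_exp_neg_div_two_mul_nhdsGT_zero {d : ℝ} (hd : 0 < d) :
    Tendsto (fun ε : ℝ => Real.exp (-d / (2 * ε))) (nhdsWithin 0 (Set.Ioi 0)) (nhds 0) := by
  refine Real.tendsto_exp_atBot.comp ?_
  have h := (tendsto_inv_nhdsGT_zero (𝕜 := ℝ)).const_mul_atTop_of_neg
    (show -d / 2 < 0 by linarith)
  refine h.congr fun ε => ?_
  rw [← div_eq_mul_inv, div_div]

/-- Among weights `C ε * exp (-a / (2 * ε))` with convergent prefactors, a larger exponent
is negligible as `ε → 0⁺`. -/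
lemma tendsto_mul_exp_div_mul_exp_nhdsGT_zero {a b c d : ℝ} (hab : a < b) {C D : ℝ → ℝ}
    (hC : Tendsto C (nhdsWithin 0 (Set.Ioi 0)) (nhds c))
    (hD : Tendsto D (nhdsWithin 0 (Set.Ioi 0)) (nhds d)) (hd : d ≠ 0) :
    Tendsto (fun ε => (C ε * Real.exp (-b / (2 * ε))) / (D ε * Real.exp (-a / (2 * ε))))
      (nhdsWithin 0 (Set.Ioi 0)) (nhds 0) := by
  have h := (hC.div hD hd).mul (tendsto_exp_neg_div_two_mul_nhdsGT_zero (sub_pos.2 hab))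
  rw [mul_zero] at h
  refine h.congr fun ε => ?_
  rw [mul_div_mul_comm, ← Real.exp_sub, Pi.div_apply]
  congr 2
  ring

/-- Zero-variance limit of the modified Pitman–Yor Gibbs assignment probabilities:
as `ε → 0⁺`, the point `x` is assigned according to the minimizer of
`{λ − θ·ln c, θ + ‖x − μ k‖² (k = 1, …, c)}`. -/
theorem stmt5 {E : Type*} [NormedAddCommGroup E] [InnerProductSpace ℝ E]
    (x : E) (c : ℕ) (hc : 1 ≤ c) (μ : Fin c → E) (nsz : Fin c → ℕ)
    (hn : ∀ k, 0 < nsz k) (lam θ ρ : ℝ) (hρ : 0 < ρ)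
    (q : Fin c → ℝ → ℝ)
    (hq : ∀ k ε, q k ε = (nsz k : ℝ) * Real.exp (-(θ + ‖x - μ k‖ ^ 2) / (2 * ε)))
    (qnew : ℝ → ℝ)
    (hqnew : ∀ ε, qnew ε =
      Real.exp (-(lam - θ * Real.log (c : ℝ)) / (2 * ε) - ‖x‖ ^ 2 / (ε + ρ)))
    (Z : ℝ → ℝ) (hZ : ∀ ε, Z ε = qnew ε + ∑ k, q k ε) :
    ((∀ k, lam - θ * Real.log (c : ℝ) < θ + ‖x - μ k‖ ^ 2) →
      Tendsto (fun ε => qnew ε / Z ε) (nhdsWithin 0 (Set.Ioi 0)) (nhds 1)) ∧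
    (∀ k₀ : Fin c, θ + ‖x - μ k₀‖ ^ 2 < lam - θ * Real.log (c : ℝ) →
      (∀ k, k ≠ k₀ → ‖x - μ k₀‖ ^ 2 < ‖x - μ k‖ ^ 2) →
      Tendsto (fun ε => q k₀ ε / Z ε) (nhdsWithin 0 (Set.Ioi 0)) (nhds 1)) := by
  have hD : Tendsto (fun ε : ℝ => Real.exp (-(‖x‖ ^ 2 / (ε + ρ)))) (nhdsWithin 0 (Set.Ioi 0))
      (nhds (Real.exp (-(‖x‖ ^ 2 / (0 + ρ))))) := by
    have h : ContinuousAt (fun ε : ℝ => Real.exp (-(‖x‖ ^ 2 / (ε + ρ)))) 0 := by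
      have : (0 : ℝ) + ρ ≠ 0 := by linarith
      fun_prop (disch := assumption)
    exact h.tendsto.mono_left nhdsWithin_le_nhds
  have hnew : ∀ ε, qnew ε = Real.exp (-(‖x‖ ^ 2 / (ε + ρ))) *
      Real.exp (-(lam - θ * Real.log (c : ℝ)) / (2 * ε)) := by
    intro ε
    rw [hqnew, ← Real.exp_add]
    congr 1
    ring
  have hsz : ∀ k, (nsz k : ℝ) ≠ 0 := fun k => by exact_mod_cast (hn k).ne'
  refine ⟨fun h => ?_, fun k₀ h₀ h => ?_⟩
  · have hk : ∀ k, Tendsto (fun ε => q k ε / qnew ε) (nhdsWithin 0 (Set.Ioi 0)) (nhds 0) := by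
      intro k
      simp only [hq, hnew]
      exact tendsto_mul_exp_div_mul_exp_nhdsGT_zero (h k) tendsto_const_nhds hD
        (Real.exp_ne_zero _)
    have hZq := ((tendsto_finsetSum Finset.univ fun k _ => hk k).const_add 1).inv₀ (by simp)
    simp only [Finset.sum_const_zero, add_zero, inv_one] at hZq
    refine hZq.congr fun ε => ?_
    have hne : qnew ε ≠ 0 := by rw [hqnew]; exact Real.exp_ne_zero _
    rw [← inv_div, hZ, add_div, div_self hne, Finset.sum_div]
  · have hk : ∀ k, Tendsto (fun ε => q k ε / q k₀ ε) (nhdsWithin 0 (Set.Ioi 0))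
        (nhds (if k = k₀ then 1 else 0)) := by
      intro k
      split_ifs with hkk
      · subst hkk
        refine tendsto_const_nhds.congr fun ε => (div_self ?_).symm
        rw [hq]
        exact mul_ne_zero (hsz k) (Real.exp_ne_zero _)
      · simp only [hq]
        exact tendsto_mul_exp_div_mul_exp_nhdsGT_zero (by linarith [h k hkk]) tendsto_const_nhds
          tendsto_const_nhds (hsz k₀)
    have hnew₀ : Tendsto (fun ε => qnew ε / q k₀ ε) (nhdsWithin 0 (Set.Ioi 0)) (nhds 0) := by
      simp only [hq, hnew]
      exact tendsto_mul_exp_div_mul_exp_nhdsGT_zero h₀ hD tendsto_const_nhds (hsz k₀)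
    have hZq := (hnew₀.add (tendsto_finsetSum Finset.univ fun k _ => hk k)).inv₀ (by simp)
    simp only [Finset.sum_ite_eq', Finset.mem_univ, if_true, zero_add, inv_one] at hZq
    refine hZq.congr fun ε => ?_
    rw [← inv_div (Z ε), hZ, add_div, Finset.sum_div]
end

section
/- Let E be a real inner product space, x ∈ E, let μ₁, …, μ_c ∈ E (c ≥ 1) be existing cluster centers with positive sizes n₁, …, n_c, and let λ ∈ ℝ and ρ > 0. For ε > 0 define the unnormalized Gibbs weights q_k(ε) = n_k·exp(−‖x − μ_k‖²/(2ε)) for existing clusters k and q_new(ε) = exp(−λ/(2ε) − ‖x‖²/(2(ε+ρ))) for a new cluster, with Z(ε) = q_new(ε) + Σ_k q_k(ε). Then as ε → 0⁺: (i) if λ < min_k ‖x − μ_k‖², then q_new(ε)/Z(ε) → 1; (ii) if there is k₀ with ‖x − μ_{k₀}‖² < λ and ‖x − μ_{k₀}‖² < ‖x − μ_k‖² for all k ≠ k₀, then q_{k₀}(ε)/Z(ε) → 1. Hence in the limit the point x is assigned according to the minimizer of {λ, ‖x − μ_k‖², k = 1, …, c}. -/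
open Filter

open Asymptotics in
/-- Boltzmann weights `g ε * exp (-a / (2 ε))` with convergent prefactors are ordered by their
energies `a` as `ε → 0⁺`. -/
theorem isLittleO_mul_exp_neg_div {a b A B : ℝ} {f g : ℝ → ℝ} (hab : a < b) (hA : A ≠ 0)
    (hf : Tendsto f (nhdsWithin 0 (Set.Ioi 0)) (nhds A))
    (hg : Tendsto g (nhdsWithin 0 (Set.Ioi 0)) (nhds B)) :
    (fun ε => g ε * Real.exp (-b / (2 * ε))) =o[nhdsWithin 0 (Set.Ioi 0)]
      (fun ε => f ε * Real.exp (-a / (2 * ε))) := by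
  have hgf : g =O[nhdsWithin 0 (Set.Ioi 0)] f :=
    (hg.isBigO_one ℝ).trans ((isBigO_const_left_iff_pos_le_norm one_ne_zero).2
      ⟨‖A‖ / 2, by positivity,
        (hf.norm.eventually (lt_mem_nhds (half_lt_self (norm_pos_iff.2 hA)))).mono
          fun _ h => h.le⟩)
  refine hgf.mul_isLittleO (Real.isLittleO_exp_comp_exp_comp.2 ?_)
  have h : Tendsto (fun ε : ℝ => (b - a) / 2 * ε⁻¹) (nhdsWithin 0 (Set.Ioi 0)) atTop :=
    tendsto_inv_nhdsGT_zero.const_mul_atTop (by linarith)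
  refine h.congr fun ε => ?_
  ring

open Asymptotics in
/-- Adding a negligible term to a nowhere-vanishing function leaves a ratio tending to `1`. -/
theorem tendsto_div_add_isLittleO {α : Type*} {l : Filter α} {f r : α → ℝ} (hr : r =o[l] f)
    (hf : ∀ ε, f ε ≠ 0) : Tendsto (fun ε => f ε / (f ε + r ε)) l (nhds 1) := by
  have h : Tendsto (fun ε => (1 + r ε / f ε)⁻¹) l (nhds 1) := by
    simpa using (hr.tendsto_div_nhds_zero.const_add 1).inv₀ (by norm_num)
  refine h.congr fun ε => ?_
  rw [one_add_div (hf ε), inv_div]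

/-- Zero-variance limit of the Dirichlet-process (dp-means) Gibbs assignment
probabilities: as `ε → 0⁺`, the point `x` is assigned according to the minimizer of
`{λ, ‖x − μ k‖² (k = 1, …, c)}`. -/
theorem stmt6 {E : Type*} [NormedAddCommGroup E] [InnerProductSpace ℝ E]
    (x : E) (c : ℕ) (hc : 1 ≤ c) (μ : Fin c → E) (nsz : Fin c → ℕ)
    (hn : ∀ k, 0 < nsz k) (lam ρ : ℝ) (hρ : 0 < ρ)
    (q : Fin c → ℝ → ℝ)
    (hq : ∀ k ε, q k ε = (nsz k : ℝ) * Real.exp (-‖x - μ k‖ ^ 2 / (2 * ε)))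
    (qnew : ℝ → ℝ)
    (hqnew : ∀ ε, qnew ε = Real.exp (-lam / (2 * ε) - ‖x‖ ^ 2 / (2 * (ε + ρ))))
    (Z : ℝ → ℝ) (hZ : ∀ ε, Z ε = qnew ε + ∑ k, q k ε) :
    ((∀ k, lam < ‖x - μ k‖ ^ 2) →
      Tendsto (fun ε => qnew ε / Z ε) (nhdsWithin 0 (Set.Ioi 0)) (nhds 1)) ∧
    (∀ k₀ : Fin c, ‖x - μ k₀‖ ^ 2 < lam →
      (∀ k, k ≠ k₀ → ‖x - μ k₀‖ ^ 2 < ‖x - μ k‖ ^ 2) →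
      Tendsto (fun ε => q k₀ ε / Z ε) (nhdsWithin 0 (Set.Ioi 0)) (nhds 1)) := by
  have hqnew' : qnew = fun ε =>
      Real.exp (-(‖x‖ ^ 2 / (2 * (ε + ρ)))) * Real.exp (-lam / (2 * ε)) := by
    funext ε
    rw [hqnew, ← Real.exp_add]
    ring_nf
  have hq' : ∀ k, q k = fun ε => (nsz k : ℝ) * Real.exp (-‖x - μ k‖ ^ 2 / (2 * ε)) :=
    fun k => funext (hq k)
  have hprior : Tendsto (fun ε : ℝ => Real.exp (-(‖x‖ ^ 2 / (2 * (ε + ρ)))))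
      (nhdsWithin 0 (Set.Ioi 0)) (nhds (Real.exp (-(‖x‖ ^ 2 / (2 * (0 + ρ)))))) := by
    have : ContinuousAt (fun ε : ℝ => Real.exp (-(‖x‖ ^ 2 / (2 * (ε + ρ))))) 0 := by
      fun_prop (disch := positivity)
    exact this.tendsto.mono_left nhdsWithin_le_nhds
  have hn0 : ∀ k, (nsz k : ℝ) ≠ 0 := fun k => by exact_mod_cast (hn k).ne'
  constructor
  · intro h
    have hr : (fun ε => ∑ k, q k ε) =o[nhdsWithin 0 (Set.Ioi 0)] qnew := by
      refine Asymptotics.IsLittleO.fun_sum fun k _ => ?_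
      rw [hq', hqnew']
      exact isLittleO_mul_exp_neg_div (h k) (Real.exp_ne_zero _) hprior tendsto_const_nhds
    simp only [hZ]
    exact tendsto_div_add_isLittleO hr fun ε => by rw [hqnew]; exact Real.exp_ne_zero _
  · intro k₀ hlam hmin
    have hr : (fun ε => qnew ε + ∑ k ∈ Finset.univ.erase k₀, q k ε)
        =o[nhdsWithin 0 (Set.Ioi 0)] q k₀ := by
      refine Asymptotics.IsLittleO.add ?_ (Asymptotics.IsLittleO.fun_sum fun k hk => ?_)
      · rw [hq', hqnew']
        exact isLittleO_mul_exp_neg_div hlam (hn0 k₀) tendsto_const_nhds hprior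
      · rw [hq', hq']
        exact isLittleO_mul_exp_neg_div (hmin k (Finset.ne_of_mem_erase hk)) (hn0 k₀)
          tendsto_const_nhds tendsto_const_nhds
    refine (tendsto_div_add_isLittleO hr fun ε => ?_).congr fun ε => ?_
    · rw [hq]
      exact mul_ne_zero (hn0 k₀) (Real.exp_ne_zero _)
    · rw [hZ, ← Finset.add_sum_erase _ _ (Finset.mem_univ k₀), add_left_comm]
end

section
/- Let n ≥ 1, let z : Fin n → ℕ be a sequence of cluster labels, let a, b be real numbers and f : ℕ → ℝ a function. For each index i, let p_i be the number of indices j < i with z_j = z_i, and let c_i be the number of distinct values among (z_j)_{j<i}. Define the sequential allocation weight w_i = a·p_i if p_i > 0 (assignment to an existing cluster of current size p_i) and w_i = b·f(c_i) if p_i = 0 (creation of a new cluster when c_i clusters exist). Let c be the total number of distinct labels in z and, for each distinct label k, let m_k be its multiplicity. Then the product of weights satisfies Π_{i} w_i = a^(n−c) · b^c · (Π_{j=0}^{c−1} f(j)) · Π_{k} (m_k − 1)!. In particular, the unnormalized joint probability depends only on the multiset of cluster sizes {m_k} and not on the order of the sequence (exchangeability of the modified Pitman–Yor allocation paradigm).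 -/
open Finset

/-- The product of the sequential allocation weights along a finite linearly ordered index set. -/
theorem prod_allocation_weight {ι κ R : Type*} [LinearOrder ι] [DecidableEq κ] [CommSemiring R]
    (z : ι → κ) (a b : R) (f : ℕ → R) (s : Finset ι) :
    ∏ i ∈ s, (if 0 < #{j ∈ s | j < i ∧ z j = z i} then a * (#{j ∈ s | j < i ∧ z j = z i} : R)
      else b * f #({j ∈ s | j < i}.image z)) =
      a ^ (#s - #(s.image z)) * b ^ #(s.image z) * (∏ j ∈ range #(s.image z), f j) *
        ∏ k ∈ s.image z, ((#{i ∈ s | z i = k} - 1).factorial : R) := by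
  induction s using Finset.induction_on_max with
  | empty => simp
  | insert x s hx ih =>
    have hxs : x ∉ s := fun h => lt_irrefl x (hx x h)
    have filter_lt_old (i : ι) (hi : i ∈ s) :
        {j ∈ insert x s | j < i} = {j ∈ s | j < i} := by
      rw [filter_insert, if_neg (hx i hi).not_gt]
    have filter_eq_old (i : ι) (hi : i ∈ s) :
        {j ∈ insert x s | j < i ∧ z j = z i} = {j ∈ s | j < i ∧ z j = z i} := by
      rw [filter_insert, if_neg fun h => (hx i hi).not_gt h.1]
    have filter_lt_new : {j ∈ insert x s | j < x} = s := by
      rw [filter_insert, if_neg (lt_irrefl x), filter_true_of_mem hx]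
    have filter_eq_new :
        {j ∈ insert x s | j < x ∧ z j = z x} = {j ∈ s | z j = z x} := by
      rw [filter_insert, if_neg fun h => lt_irrefl x h.1]
      exact filter_congr fun j hj => and_iff_right (hx j hj)
    have size_new : #{i ∈ insert x s | z i = z x} = #{i ∈ s | z i = z x} + 1 := by
      rw [filter_insert, if_pos rfl, card_insert_of_notMem (by simp [hxs])]
    have prod_factorial_old (t : Finset κ) (ht : z x ∉ t) :
        ∏ k ∈ t, ((#{i ∈ insert x s | z i = k} - 1).factorial : R) =
          ∏ k ∈ t, ((#{i ∈ s | z i = k} - 1).factorial : R) :=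
      prod_congr rfl fun k hk => by
        rw [filter_insert, if_neg (ne_of_mem_of_not_mem hk ht).symm]
    rw [prod_insert hxs, filter_lt_new, filter_eq_new,
      prod_congr rfl fun i hi => by rw [filter_lt_old i hi, filter_eq_old i hi], ih, image_insert,
      card_insert_of_notMem hxs]
    have hle : #(s.image z) ≤ #s := card_image_le
    by_cases hz : z x ∈ s.image z
    · have hpos : 0 < #{i ∈ s | z i = z x} := by
        obtain ⟨y, hy, hyx⟩ := mem_image.1 hz
        exact card_pos.2 ⟨y, mem_filter.2 ⟨hy, hyx⟩⟩
      rw [if_pos hpos, insert_eq_of_mem hz, ← mul_prod_erase _ _ hz, ← mul_prod_erase _ _ hz,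
        size_new, Nat.add_sub_cancel, ← Nat.mul_factorial_pred hpos.ne', Nat.sub_add_comm hle,
        prod_factorial_old _ (notMem_erase _ _)]
      push_cast
      ring
    · have hzero : #{i ∈ s | z i = z x} = 0 :=
        card_eq_zero.2 (filter_eq_empty_iff.2 fun y hy hyx => hz (mem_image.2 ⟨y, hy, hyx⟩))
      rw [hzero, if_neg (lt_irrefl 0), card_insert_of_notMem hz, prod_insert hz, size_new, hzero,
        prod_range_succ, Nat.add_sub_add_right, prod_factorial_old _ hz]
      simp only [zero_add, Nat.sub_self, Nat.factorial_zero, Nat.cast_one]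
      ring

/-- Exchangeability of the modified Pitman–Yor sequential allocation: the product of the
sequential allocation weights equals
`a^(n−c) · b^c · (Π_{j=0}^{c−1} f(j)) · Π_k (m_k − 1)!`, which depends only on the
multiset of cluster sizes and not on the order of the label sequence. -/
theorem stmt7 (n : ℕ) (hn : 1 ≤ n) (z : Fin n → ℕ) (a b : ℝ) (f : ℕ → ℝ)
    (p : Fin n → ℕ)
    (hp : ∀ i, p i = (Finset.univ.filter (fun j => j < i ∧ z j = z i)).card)
    (cnt : Fin n → ℕ)
    (hcnt : ∀ i, cnt i = ((Finset.univ.filter (fun j => j < i)).image z).card)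
    (w : Fin n → ℝ)
    (hw : ∀ i, w i = if 0 < p i then a * (p i : ℝ) else b * f (cnt i))
    (c : ℕ) (hc : c = (Finset.univ.image z).card)
    (m : ℕ → ℕ)
    (hm : ∀ k, m k = (Finset.univ.filter (fun i => z i = k)).card) :
    ∏ i, w i = a ^ (n - c) * b ^ c * (∏ j ∈ Finset.range c, f j) *
      ∏ k ∈ Finset.univ.image z, ((m k - 1).factorial : ℝ) := by
  subst hc
  simp only [hw, hp, hcnt, hm]
  simpa using prod_allocation_weight z a b f univ
end

section
/- Let λ, θ be real numbers with θ > 0, let c ≥ 1 be a natural number, and let d be a real number satisfying d − θ > λ − θ·ln c. Then d > λ − θ·ln((c+1)^(c+1)/c^c) = (λ − θ·ln(c+1))·(c+1) − (λ − θ·ln c)·c. Consequently, if a data point's minimum squared distance d to the existing c cluster centers exceeds the threshold (i.e., the point is λ-out), then making it the center of a new singleton cluster — which removes its contribution d from the km-cost and increases the cluster-number penalty from (λ − θ·ln c)·c to (λ − θ·ln(c+1))·(c+1) — strictly decreases the pyp-means objective. -/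
/-- If a λ-out point's minimum squared distance `d` to the `c` existing centers satisfies
`d − θ > λ − θ·ln c`, then `d` exceeds the penalty increment
`λ − θ·ln((c+1)^(c+1)/c^c) = (λ − θ·ln(c+1))·(c+1) − (λ − θ·ln c)·c`, so making the point
a new singleton cluster strictly decreases the pyp-means objective. -/
theorem stmt9 (lam θ : ℝ) (hθ : 0 < θ) (c : ℕ) (hc : 1 ≤ c) (d : ℝ)
    (hd : d - θ > lam - θ * Real.log (c : ℝ)) :
    (d > lam - θ * Real.log (((c : ℝ) + 1) ^ (c + 1) / (c : ℝ) ^ c)) ∧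
    (lam - θ * Real.log (((c : ℝ) + 1) ^ (c + 1) / (c : ℝ) ^ c)
      = (lam - θ * Real.log ((c : ℝ) + 1)) * ((c : ℝ) + 1)
        - (lam - θ * Real.log (c : ℝ)) * (c : ℝ)) ∧
    (∀ K : ℝ, K + (lam - θ * Real.log ((c : ℝ) + 1)) * ((c : ℝ) + 1)
      < (K + d) + (lam - θ * Real.log (c : ℝ)) * (c : ℝ)) := by
  have hc0 : (0 : ℝ) < c := by exact_mod_cast hc
  have hlog : Real.log (((c : ℝ) + 1) ^ (c + 1) / (c : ℝ) ^ c)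
      = ((c : ℝ) + 1) * Real.log ((c : ℝ) + 1) - c * Real.log c := by
    rw [Real.log_div (by positivity) (by positivity), Real.log_pow, Real.log_pow]
    push_cast
    ring
  have hmono : Real.log (c : ℝ) ≤ Real.log ((c : ℝ) + 1) :=
    Real.log_le_log hc0 (by linarith)
  have hpos : 0 ≤ θ * (((c : ℝ) + 1) * (Real.log ((c : ℝ) + 1) - Real.log c)) :=
    mul_nonneg hθ.le (mul_nonneg (by linarith) (sub_nonneg.2 hmono))
  rw [hlog]
  refine ⟨?_, by ring, fun K => ?_⟩ <;> nlinarith only [hpos, hd, hθ]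
end
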